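/- arXiv:2005.03352 — 2 statements merged into one kernel-verified Lean document; each statement's English description precedes it below -/
import Mathlib

section
/- Assume all price sensitivities are equal: β i = β > 0 for every i. Then there exists a unique real number z > 1 satisfying (z − 1)·exp(z) = ∑_{i=1}^n exp(g i/(1−r)). Moreover, for this z, the uniform price vector p with p i = (1−r)·z/β for all i satisfies z · φ*_{n+1}(p) = 1 and R(p) = (1−r)·(z − 1)/β. -/
/-- Asymptotic market share of product `i` at price vector `p` (equal sensitivities `β`). -/
noncomputable def marketShare (n : ℕ) (g : Fin n → ℝ) (β r : ℝ) (p : Fin n → ℝ)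
    (i : Fin n) : ℝ :=
  Real.exp ((g i - β * p i) / (1 - r)) /
    (1 + ∑ j, Real.exp ((g j - β * p j) / (1 - r)))

/-- No-purchase market share at price vector `p`. -/
noncomputable def noPurchaseShare (n : ℕ) (g : Fin n → ℝ) (β r : ℝ) (p : Fin n → ℝ) : ℝ :=
  1 / (1 + ∑ j, Real.exp ((g j - β * p j) / (1 - r)))

theorem strictMonoOn_sub_one_mul_exp :
    StrictMonoOn (fun z : ℝ => (z - 1) * Real.exp z) (Set.Ici 1) := by
  intro x hx y _ hxy
  exact mul_lt_mul'' (sub_lt_sub_right hxy 1) (Real.exp_lt_exp.2 hxy)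
    (sub_nonneg.2 hx) (Real.exp_pos x).le

theorem existsUnique_sub_one_mul_exp_eq {S : ℝ} (hS : 0 < S) :
    ∃! z : ℝ, 1 < z ∧ (z - 1) * Real.exp z = S := by
  have hcont : ContinuousOn (fun z : ℝ => (z - 1) * Real.exp z) (Set.Icc 1 (1 + S)) := by
    fun_prop
  have hle : S ≤ (1 + S - 1) * Real.exp (1 + S) := by
    have : 1 ≤ Real.exp (1 + S) := Real.one_le_exp (by positivity)
    nlinarith
  obtain ⟨z, hz, hzS⟩ := intermediate_value_Icc (by linarith) hcont
    (show S ∈ Set.Icc _ _ from ⟨by simpa using hS.le, hle⟩)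
  dsimp only at hzS
  have hz1 : 1 < z := by
    refine lt_of_le_of_ne hz.1 ?_
    rintro rfl
    simp at hzS
    exact hS.ne hzS
  refine ⟨z, ⟨hz1, hzS⟩, fun y hy => ?_⟩
  exact strictMonoOn_sub_one_mul_exp.injOn hy.1.le hz1.le (hy.2.trans hzS.symm)

/-- At the uniform price `(1 - r) * z / β`, the total attraction of the products is `z - 1`. -/
theorem sum_exp_uniform_price {n : ℕ} {g : Fin n → ℝ} {β r z : ℝ} (hβ : β ≠ 0) (hr : 1 - r ≠ 0)
    (hz : (z - 1) * Real.exp z = ∑ i, Real.exp (g i / (1 - r))) :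
    ∑ i, Real.exp ((g i - β * ((1 - r) * z / β)) / (1 - r)) = z - 1 := by
  have h (i : Fin n) : (g i - β * ((1 - r) * z / β)) / (1 - r) = g i / (1 - r) - z := by
    field_simp
  simp_rw [h, Real.exp_sub, ← Finset.sum_div, ← hz]
  exact mul_div_cancel_right₀ _ (Real.exp_ne_zero z)

/-- With equal price sensitivities there is a unique normalised monopolistic price `z > 1`
solving `(z−1)e^z = ∑ᵢ e^{gᵢ/(1−r)}`, and the corresponding uniform price
`pᵢ = (1−r)z/β` satisfies `z·φ*_{n+1}(p) = 1` and `R(p) = (1−r)(z−1)/β`. -/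
theorem monopolistic_price_characterisation
    (n : ℕ) (hn : 2 ≤ n) (g : Fin n → ℝ) (β r : ℝ)
    (hβ : 0 < β) (hr0 : 0 < r) (hr1 : r < 1) :
    (∃! z : ℝ, 1 < z ∧ (z - 1) * Real.exp z = ∑ i, Real.exp (g i / (1 - r))) ∧
    ∀ z : ℝ, 1 < z → (z - 1) * Real.exp z = ∑ i, Real.exp (g i / (1 - r)) →
      (z * noPurchaseShare n g β r (fun _ => (1 - r) * z / β) = 1 ∧
       (∑ i, ((1 - r) * z / β) *
          marketShare n g β r (fun _ => (1 - r) * z / β) i)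
            = (1 - r) * (z - 1) / β) := by
  have hr : 1 - r ≠ 0 := (sub_pos.2 hr1).ne'
  have : NeZero n := ⟨by omega⟩
  refine ⟨existsUnique_sub_one_mul_exp_eq
    (Finset.sum_pos (fun i _ => Real.exp_pos _) Finset.univ_nonempty), fun z hz1 hz => ?_⟩
  have hz0 : z ≠ 0 := by positivity
  have hsum := sum_exp_uniform_price hβ.ne' hr hz
  constructor
  · simp only [noPurchaseShare, hsum, add_sub_cancel]
    exact mul_one_div_cancel hz0
  · simp only [marketShare, hsum, add_sub_cancel]
    rw [← Finset.mul_sum, ← Finset.sum_div, hsum]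
    field_simp
end

section
/- Assume all price sensitivities are equal: β i = β > 0 for every i. Let z^M > 1 satisfy (z^M − 1)·exp(z^M) = ∑_{i=1}^n exp(g i/(1−r)) and set p^M = (1−r)·z^M/β (the monopolistic price). Let p^C ∈ (0,∞)^n satisfy β · p^C_i · (1 − φ*_i(p^C)) = 1 − r for all i (the competitive price). Then p^C_i < p^M for every i ∈ {1,…,n}: the monopolistic price is higher than each competitive price. -/
/-- With equal price sensitivities, the monopolistic price is higher than each
coordinate of the competitive price. -/
theorem monopolistic_price_higher_than_competitive
    (n : ℕ) (hn : 2 ≤ n) (g : Fin n → ℝ) (β r : ℝ)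
    (hβ : 0 < β) (hr0 : 0 < r) (hr1 : r < 1)
    (zM : ℝ) (hzM : 1 < zM)
    (hzMeq : (zM - 1) * Real.exp zM = ∑ i, Real.exp (g i / (1 - r)))
    (pC : Fin n → ℝ) (hpC : ∀ i, 0 < pC i)
    (hfoc : ∀ i, β * pC i * (1 - marketShare n g β r pC i) = 1 - r) :
    ∀ i, pC i < (1 - r) * zM / β := by
  have hr : 0 < 1 - r := by linarith
  have : Nonempty (Fin n) := ⟨⟨0, by omega⟩⟩
  have : Nontrivial (Fin n) := Fin.nontrivial_iff_two_le.mpr hn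
  obtain ⟨k, hk⟩ := Finite.exists_max pC
  suffices h : pC k < (1 - r) * zM / β from fun i => (hk i).trans_lt h
  set a : Fin n → ℝ := fun i => Real.exp (g i / (1 - r)) with ha
  set x : ℝ := β * pC k / (1 - r) with hx
  set t : ℝ := Real.exp (-x) with ht
  set S : ℝ := ∑ j, Real.exp ((g j - β * pC j) / (1 - r)) with hS
  have htpos : 0 < t := Real.exp_pos _
  have hSnonneg : 0 ≤ S := Finset.sum_nonneg fun j _ => (Real.exp_pos _).le
  have hsplit : ∀ j, Real.exp ((g j - β * pC k) / (1 - r)) = a j * t := by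
    intro j
    rw [ha, ht, hx, ← Real.exp_add]
    congr 1
    ring
  have hSge : (∑ j, a j) * t ≤ S := by
    rw [Finset.sum_mul]
    refine Finset.sum_le_sum fun j _ => ?_
    rw [← hsplit j]
    have := hk j
    gcongr
  have hak : a k < ∑ j, a j := by
    obtain ⟨j, hj⟩ := exists_ne k
    exact Finset.single_lt_sum hj (Finset.mem_univ k) (Finset.mem_univ j) (Real.exp_pos _)
      fun _ _ _ => (Real.exp_pos _).le
  have hfock : (x - 1) * (1 + S) = x * (a k * t) := by
    have h := hfoc k
    have hβp : β * pC k = x * (1 - r) := (div_mul_cancel₀ _ hr.ne').symm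
    rw [marketShare, hsplit k, ← hS, hβp] at h
    have h1 : x * (1 - a k * t / (1 + S)) = 1 :=
      mul_right_cancel₀ hr.ne' (by linarith)
    have hne : 1 + S ≠ 0 := (add_pos_of_pos_of_nonneg one_pos hSnonneg).ne'
    rw [one_sub_div hne, mul_div_assoc', div_eq_one_iff_eq hne] at h1
    linarith
  have hxz : x < zM := by
    by_contra! hzx
    have hAt : (∑ j, a j) * t ≤ zM - 1 := by
      rw [← hzMeq, mul_assoc, ht, ← Real.exp_add]
      exact mul_le_of_le_one_right (by linarith) (Real.exp_le_one_iff.mpr (by linarith))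
    have h1 : (x - 1) * (1 + (∑ j, a j) * t) ≤ (x - 1) * (1 + S) :=
      mul_le_mul_of_nonneg_left (by linarith) (by linarith)
    have h2 : x * (a k * t) < x * ((∑ j, a j) * t) :=
      mul_lt_mul_of_pos_left (mul_lt_mul_of_pos_right hak htpos) (by linarith)
    linarith
  rw [hx, div_lt_iff₀ hr] at hxz
  rw [lt_div_iff₀ hβ]
  linarith
end
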